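/- Let a group G act without inversion on locally finite pocsets P and P', let f : P → P' be a G-equivariant resolution, and let φ : P → P/∼ be the elementary fold generated by the elementary foldable pair h₁ ∼ h₂. If [ĥ] and [k̂] are transverse hyperplanes in P/∼, then, up to interchanging [ĥ] and [k̂], there exist ∼-classes of halfspaces [h] and [k] orienting [ĥ] and [k̂] such that one of the following holds: (1) there exist h ∈ [h] and k ∈ [k] that are transverse in P; (2) there exist g ∈ G and k ∈ [k] such that, up to interchanging h₁ and h₂, the classes satisfy [g·h₁] = [g·h₂] = [h] and (g·h₁)* < k < g·h₂. Conversely, if there exist hyperplanes ĥ, ĥ', k̂ of P with ĥ ∼ ĥ', ĥ ≠ ĥ', and k̂ separating ĥ and ĥ', then [ĥ] and [k̂] are transverse in P/∼. -/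

import Mathlib

/- Pocsets, hyperplanes, admissible equivalence relations, quotients,
   admissible maps, embeddings, resolutions, group actions on pocsets,
   elementary folds and folding sequences. -/

universe u v w

/-- A pocset: a poset with an order-reversing involution `star` such that
`h ≠ h *` and `h`, `h *` are incomparable. -/
structure Pocset (P : Type u) where
  le : P → P → Prop
  star : P → P
  le_refl : ∀ a, le a a
  le_trans : ∀ {a b c}, le a b → le b c → le a c
  le_antisymm : ∀ {a b}, le a b → le b a → a = b
  star_star : ∀ a, star (star a) = a
  star_antitone : ∀ {a b}, le a b → le (star b) (star a)
  ne_star : ∀ a, a ≠ star a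
  not_le_star : ∀ a, ¬ le a (star a)
  not_star_le : ∀ a, ¬ le (star a) a

namespace Pocset

variable {P : Type u} {P' : Type v}

/-- Strict order. -/
def lt (Q : Pocset P) (a b : P) : Prop := Q.le a b ∧ a ≠ b

/-- The orientations of the hyperplane `ĥ` determined by the halfspace `h`. -/
def orient (Q : Pocset P) (h : P) : Set P := {h, Q.star h}

/-- `k` is an orientation of the same hyperplane as `h`, i.e. `k̂ = ĥ`. -/
def sameHyp (Q : Pocset P) (h k : P) : Prop := k = h ∨ k = Q.star h

/-- The hyperplanes `ĥ` and `k̂` are transverse: they are distinct and no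
orientation of `ĥ` is comparable with any orientation of `k̂`. -/
def transverse (Q : Pocset P) (h k : P) : Prop :=
  ¬ Q.sameHyp h k ∧ ∀ a ∈ Q.orient h, ∀ b ∈ Q.orient k, ¬ Q.le a b ∧ ¬ Q.le b a

/-- Two hyperplanes are disjoint if they are distinct and not transverse. -/
def disjointHyp (Q : Pocset P) (h k : P) : Prop :=
  ¬ Q.sameHyp h k ∧ ¬ Q.transverse h k

/-- The halfspaces `h` and `k` are facing: `h* < k`. -/
def facing (Q : Pocset P) (h k : P) : Prop := Q.lt (Q.star h) k

/-- The halfspaces `h` and `k` are compatible: not `k ≤ h*`. -/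
def compatible (Q : Pocset P) (h k : P) : Prop := ¬ Q.le k (Q.star h)

/-- The hyperplane `k̂` separates the hyperplanes `ĥ` and `l̂`: there are
orientations with `a < b < c`. -/
def separates (Q : Pocset P) (k h l : P) : Prop :=
  ∃ a ∈ Q.orient h, ∃ b ∈ Q.orient k, ∃ c ∈ Q.orient l, Q.lt a b ∧ Q.lt b c

/-- Local finiteness: every interval is finite. -/
def LocallyFinite (Q : Pocset P) : Prop :=
  ∀ a b : P, {c : P | Q.le a c ∧ Q.le c b}.Finite

/-- The equivalence relation induced on hyperplanes by a relation `r` on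
halfspaces: `ĥ ∼ k̂` iff `h ∼ k` or `h ∼ k*`. -/
def hypRel (Q : Pocset P) (r : P → P → Prop) (h k : P) : Prop :=
  r h k ∨ r h (Q.star k)

/-- An admissible equivalence relation on a pocset. -/
structure IsAdmissible (Q : Pocset P) (r : P → P → Prop) : Prop where
  equiv : Equivalence r
  aer1 : ∀ h, ¬ r h (Q.star h)
  aer2 : ∀ h k, r h k → r (Q.star h) (Q.star k)
  aer3 : ∀ h k, Q.transverse h k → ¬ r h k
  aer4 : ∀ h k, Q.hypRel r h k → ¬ Q.sameHyp h k →
    (∀ m, Q.hypRel r h m → ¬ Q.separates m h k) →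
    ∀ a ∈ Q.orient h, ∀ b ∈ Q.orient k, Q.facing a b → r a b

/-- The strict quotient relation: `[h] < [k]` iff `[h] ≠ [k]`, every pair of
representatives has disjoint hyperplanes, and `h' < k'` for every pair of
representatives whose hyperplanes are `([ĥ] ∪ [k̂])`-inseparable. -/
def QuotLT (Q : Pocset P) (r : P → P → Prop) (h k : P) : Prop :=
  ¬ r h k ∧
  (∀ h' k', r h h' → r k k' → Q.disjointHyp h' k') ∧
  (∀ h' k', r h h' → r k k' →
    (∀ m, (Q.hypRel r h m ∨ Q.hypRel r k m) → ¬ Q.separates m h' k') → Q.lt h' k')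

/-- The quotient relation: `[h] ≤ [k]` iff `[h] = [k]` or `[h] < [k]`. -/
def QuotLE (Q : Pocset P) (r : P → P → Prop) (h k : P) : Prop :=
  r h k ∨ Q.QuotLT r h k

/-- Transversality of `[ĥ]` and `[k̂]` in the quotient pocset. -/
def QuotTransverse (Q : Pocset P) (r : P → P → Prop) (h k : P) : Prop :=
  ¬ Q.hypRel r h k ∧
  ∀ a ∈ Q.orient h, ∀ b ∈ Q.orient k, ¬ Q.QuotLE r a b ∧ ¬ Q.QuotLE r b a

/-- `[k̂]` separates `[ĥ]` and `[l̂]` in the quotient pocset. -/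
def QuotSeparates (Q : Pocset P) (r : P → P → Prop) (k h l : P) : Prop :=
  ∃ a ∈ Q.orient h, ∃ b ∈ Q.orient k, ∃ c ∈ Q.orient l,
    Q.QuotLT r a b ∧ Q.QuotLT r b c

/-- `[h]` and `[k]` are facing in the quotient pocset: `[h]* < [k]`. -/
def QuotFacing (Q : Pocset P) (r : P → P → Prop) (h k : P) : Prop :=
  Q.QuotLT r (Q.star h) k

/-- An admissible map of pocsets. -/
structure IsAdmissibleMap (Q : Pocset P) (Q' : Pocset P') (f : P → P') : Prop where
  am1 : ∀ h, f (Q.star h) = Q'.star (f h)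
  am2 : ∀ h k, Q.transverse h k → Q'.transverse (f h) (f k)
  am3 : ∀ h k, Q.facing h k → Q'.sameHyp (f h) (f k) →
    (∀ m, Q'.sameHyp (f m) (f h) → ¬ Q.separates m h k) → f h = f k
  am4 : ∀ h' : P', (∀ m : P, ¬ Q'.sameHyp (f m) h') →
    ∃ b ∈ Q'.orient h', ∀ m : P, Q'.compatible b (f m)

/-- An embedding of pocsets: an injective, order-reflecting admissible map. -/
structure IsPocsetEmbedding (Q : Pocset P) (Q' : Pocset P') (f : P → P') : Prop where
  adm : IsAdmissibleMap Q Q' f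
  inj : Function.Injective f
  le_reflect : ∀ h k, Q'.le (f h) (f k) → Q.le h k

/-- The equivalence relation `∼_f` induced by a map `f`. -/
def simRel (f : P → P') : P → P → Prop := fun a b => f a = f b

/-- A resolution of pocsets: an admissible map `f` such that `∼_f` is an
admissible equivalence relation and the induced map `P/∼_f → P'` is an
embedding of pocsets (stated here on representatives: `quot_am2` and
`quot_am3` are admissibility of the induced map, `le_reflect` is
order-reflection; injectivity of the induced map is automatic, and its
properties (AM1) and (AM4) coincide with those of `f`). -/
structure IsResolution (Q : Pocset P) (Q' : Pocset P') (f : P → P') : Prop where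
  adm : IsAdmissibleMap Q Q' f
  aer : Q.IsAdmissible (simRel f)
  quot_am2 : ∀ h k, Q.QuotTransverse (simRel f) h k → Q'.transverse (f h) (f k)
  quot_am3 : ∀ h k, Q.QuotFacing (simRel f) h k → Q'.sameHyp (f h) (f k) →
    (∀ m, Q'.sameHyp (f m) (f h) → ¬ Q.QuotSeparates (simRel f) m h k) → f h = f k
  le_reflect : ∀ h k, Q'.le (f h) (f k) → Q.QuotLE (simRel f) h k

/-- A group `G` acts (without inversion) on the pocset `Q` by order-preserving
bijections commuting with `star`. -/
structure IsGAction (Q : Pocset P) (G : Type w) [Group G] [MulAction G P] : Prop where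
  smul_le : ∀ (g : G) (a b : P), Q.le a b → Q.le (g • a) (g • b)
  smul_star : ∀ (g : G) (a : P), g • Q.star a = Q.star (g • a)
  no_inversion : ∀ (g : G) (a : P), g • a ≠ Q.star a

/-- `G`-equivariance of a map. -/
def Equivariant (G : Type w) [Group G] [MulAction G P] [MulAction G P']
    (f : P → P') : Prop :=
  ∀ (g : G) (a : P), f (g • a) = g • f a

/-- An elementary foldable pair for a resolution `f`: facing halfspaces with
`f h₁ = f h₂`, whose hyperplanes are `f⁻¹(f(ĥ₁))`-inseparable, such that no
pair of distinct `∼_f`-equivalent hyperplanes both separate `ĥ₁` and `ĥ₂`. -/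
def ElemFoldable (Q : Pocset P) (Q' : Pocset P') (f : P → P') (h₁ h₂ : P) : Prop :=
  Q.facing h₁ h₂ ∧ f h₁ = f h₂ ∧
  (∀ m, Q'.sameHyp (f m) (f h₁) → ¬ Q.separates m h₁ h₂) ∧
  (∀ m m', Q'.sameHyp (f m) (f m') → ¬ Q.sameHyp m m' →
    ¬ (Q.separates m h₁ h₂ ∧ Q.separates m' h₁ h₂))

/-- `r` is the smallest `G`-invariant and `star`-invariant equivalence
relation with `h₁ ∼ h₂`. -/
structure IsFoldRel (Q : Pocset P) (G : Type w) [Group G] [MulAction G P]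
    (h₁ h₂ : P) (r : P → P → Prop) : Prop where
  equiv : Equivalence r
  ginv : ∀ (g : G) (a b : P), r a b → r (g • a) (g • b)
  sinv : ∀ a b, r a b → r (Q.star a) (Q.star b)
  base : r h₁ h₂
  min : ∀ s : P → P → Prop, Equivalence s →
    (∀ (g : G) (a b : P), s a b → s (g • a) (g • b)) →
    (∀ a b, s a b → s (Q.star a) (Q.star b)) → s h₁ h₂ →
    ∀ a b, r a b → s a b

/-- `[h₁]`, `[h₂]` is an elementary foldable pair in the quotient pocset
`P/r` for the resolution induced by `f` on `P/r`. -/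
def QuotElemFoldable (Q : Pocset P) (Q' : Pocset P') (f : P → P')
    (r : P → P → Prop) (h₁ h₂ : P) : Prop :=
  Q.QuotFacing r h₁ h₂ ∧ f h₁ = f h₂ ∧
  (∀ m, Q'.sameHyp (f m) (f h₁) → ¬ Q.QuotSeparates r m h₁ h₂) ∧
  (∀ m m', Q'.sameHyp (f m) (f m') → ¬ Q.hypRel r m m' →
    ¬ (Q.QuotSeparates r m h₁ h₂ ∧ Q.QuotSeparates r m' h₁ h₂))

/-- `r'` is (the pullback to `P` of) the smallest `G`-invariant and
`star`-invariant equivalence relation on `P/r` identifying `[h₁] ∼ [h₂]`,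
i.e. the smallest `G`-invariant, `star`-invariant equivalence relation on `P`
containing `r` with `h₁ ∼ h₂`. -/
structure IsFoldStepRel (Q : Pocset P) (G : Type w) [Group G] [MulAction G P]
    (r : P → P → Prop) (h₁ h₂ : P) (r' : P → P → Prop) : Prop where
  equiv : Equivalence r'
  mono : ∀ a b, r a b → r' a b
  ginv : ∀ (g : G) (a b : P), r' a b → r' (g • a) (g • b)
  sinv : ∀ a b, r' a b → r' (Q.star a) (Q.star b)
  base : r' h₁ h₂
  min : ∀ s : P → P → Prop, Equivalence s → (∀ a b, r a b → s a b) →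
    (∀ (g : G) (a b : P), s a b → s (g • a) (g • b)) →
    (∀ a b, s a b → s (Q.star a) (Q.star b)) → s h₁ h₂ →
    ∀ a b, r' a b → s a b

/-- A finite folding sequence `P = P₀ ↝ P₁ ↝ ⋯ ↝ Pₙ` for a `G`-equivariant
resolution `f : P → P'`, encoded by the sequence of equivalence relations
`rs i` on `P` with `Pᵢ = P / rs i`: `rs 0` is equality, every `rs i` refines
`∼_f`, and each step is an elementary fold (of an elementary foldable pair
for the induced resolution `fᵢ : P/rs i → P'`). -/
def IsFoldingSequence (Q : Pocset P) (Q' : Pocset P') (G : Type w) [Group G]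
    [MulAction G P] (f : P → P') (n : ℕ)
    (rs : Fin (n + 1) → (P → P → Prop)) : Prop :=
  (∀ a b : P, rs 0 a b ↔ a = b) ∧
  (∀ (i : Fin (n + 1)) (a b : P), rs i a b → f a = f b) ∧
  (∀ i : Fin n, ∃ h₁ h₂ : P,
    Q.QuotElemFoldable Q' f (rs i.castSucc) h₁ h₂ ∧
    Q.IsFoldStepRel G (rs i.castSucc) h₁ h₂ (rs i.succ))

end Pocset

/-- One of the two cases in Lemma `unfolding1` (STATEMENT 9): there are
orientation classes `[a]` of `[ĥ]` and `[b]` of `[k̂]` such that either (1)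
some representatives are transverse, or (2) there are `g ∈ G` and `b' ∈ [b]`
with (up to interchanging `h₁` and `h₂`) `[g•h₁] = [g•h₂] = [a]` and
`(g•h₁)* < b' < g•h₂`. -/
def Pocset.foldTransCase {P : Type u} (Q : Pocset P) (G : Type w) [Group G]
    [MulAction G P] (r : P → P → Prop) (h₁ h₂ : P) (h k : P) : Prop :=
  ∃ a ∈ Q.orient h, ∃ b ∈ Q.orient k,
    (∃ a' b' : P, r a a' ∧ r b b' ∧ Q.transverse a' b') ∨
    (∃ g : G, ∃ b' : P, r b b' ∧
      ((r a (g • h₁) ∧ Q.lt (Q.star (g • h₁)) b' ∧ Q.lt b' (g • h₂)) ∨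
       (r a (g • h₂) ∧ Q.lt (Q.star (g • h₂)) b' ∧ Q.lt b' (g • h₁))))

namespace Pocset

section Order

variable {P : Type u} (Q : Pocset P) {a b c h k l m x y z : P}

theorem lt_trans' (hab : Q.lt a b) (hbc : Q.lt b c) : Q.lt a c := by
  refine ⟨Q.le_trans hab.1 hbc.1, ?_⟩
  rintro rfl
  exact hab.2 (Q.le_antisymm hab.1 hbc.1)

theorem lt_asymm' (hab : Q.lt a b) (hba : Q.lt b a) : False :=
  hab.2 (Q.le_antisymm hab.1 hba.1)

theorem star_lt_star (hab : Q.lt a b) : Q.lt (Q.star b) (Q.star a) := by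
  refine ⟨Q.star_antitone hab.1, fun e => hab.2 ?_⟩
  rw [← Q.star_star a, ← Q.star_star b, e]

theorem star_lt_comm (hab : Q.lt (Q.star a) b) : Q.lt (Q.star b) a := by
  simpa [Q.star_star] using Q.star_lt_star hab

theorem lt_star_comm (hab : Q.lt a (Q.star b)) : Q.lt b (Q.star a) := by
  simpa [Q.star_star] using Q.star_lt_star hab

theorem not_lt_of_star_lt (h₁ : Q.lt (Q.star a) b) (h₂ : Q.lt a b) : False :=
  Q.not_star_le b (Q.lt_trans' (Q.star_lt_comm h₁) h₂).1

theorem not_lt_star_of_lt (h₁ : Q.lt a b) (h₂ : Q.lt a (Q.star b)) : False :=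
  Q.not_le_star a (Q.lt_trans' h₁ (Q.lt_star_comm h₂)).1

theorem orient_star (h : P) : Q.orient (Q.star h) = Q.orient h := by
  simp only [orient, Q.star_star]
  exact Set.pair_comm _ _

theorem self_mem_orient (h : P) : h ∈ Q.orient h := Or.inl rfl

theorem star_mem_orient (h : P) : Q.star h ∈ Q.orient h := Or.inr rfl

theorem orient_eq_of_mem (ha : a ∈ Q.orient h) : Q.orient a = Q.orient h := by
  rcases ha with rfl | rfl
  · rfl
  · exact Q.orient_star h

theorem separates_congr (hx : x ∈ Q.orient h) (hy : y ∈ Q.orient k) (hz : z ∈ Q.orient l) :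
    Q.separates x y z ↔ Q.separates h k l := by
  simp only [separates, Q.orient_eq_of_mem hx, Q.orient_eq_of_mem hy, Q.orient_eq_of_mem hz]

theorem separates_comm (hs : Q.separates m h k) : Q.separates m k h := by
  obtain ⟨a, ha, b, hb, c, hc, hab, hbc⟩ := hs
  refine ⟨Q.star c, ?_, Q.star b, ?_, Q.star a, ?_, Q.star_lt_star hbc, Q.star_lt_star hab⟩
  · rw [← Q.orient_eq_of_mem hc]; exact Q.star_mem_orient c
  · rw [← Q.orient_eq_of_mem hb]; exact Q.star_mem_orient b
  · rw [← Q.orient_eq_of_mem ha]; exact Q.star_mem_orient a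

/-- A hyperplane separating two facing halfspaces lies between them. -/
theorem exists_between_of_facing (hf : Q.facing x y) (hs : Q.separates m x y) :
    ∃ b ∈ Q.orient m, Q.lt (Q.star x) b ∧ Q.lt b y := by
  obtain ⟨a, ha, b, hb, c, hc, hab, hbc⟩ := hs
  have hac := Q.lt_trans' hab hbc
  have hf' := Q.star_lt_comm hf
  rcases ha with rfl | rfl <;> rcases hc with rfl | rfl
  · exact (Q.not_lt_of_star_lt hf hac).elim
  · exact (Q.lt_asymm' hac hf').elim
  · exact ⟨b, hb, hab, hbc⟩
  · exact (Q.not_lt_star_of_lt hf hac).elim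

theorem separates_of_between (hxm : Q.lt (Q.star x) m) (hmy : Q.lt m y) : Q.separates m x y :=
  ⟨_, Q.star_mem_orient x, _, Q.self_mem_orient m, _, Q.self_mem_orient y, hxm, hmy⟩

theorem eq_or_lt_of_not_transverse (ht : ¬ Q.transverse h k) :
    k = h ∨ k = Q.star h ∨ Q.lt h k ∨ Q.lt k h ∨ Q.lt h (Q.star k) ∨ Q.lt (Q.star h) k := by
  by_cases e₁ : k = h
  · exact Or.inl e₁
  by_cases e₂ : k = Q.star h
  · exact Or.inr (Or.inl e₂)
  have n₁ : h ≠ k := fun e => e₁ e.symm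
  have n₂ : Q.star h ≠ k := fun e => e₂ e.symm
  have n₃ : h ≠ Q.star k := fun e => e₂ (by rw [e, Q.star_star])
  by_contra hc
  push Not at hc
  obtain ⟨-, -, c₁, c₂, c₃, c₄⟩ := hc
  have d₁ : ¬ Q.le h k := fun e => c₁ ⟨e, n₁⟩
  have d₂ : ¬ Q.le k h := fun e => c₂ ⟨e, e₁⟩
  have d₃ : ¬ Q.le h (Q.star k) := fun e => c₃ ⟨e, n₃⟩
  have d₄ : ¬ Q.le (Q.star h) k := fun e => c₄ ⟨e, n₂⟩
  refine ht ⟨fun e => e.elim e₁ e₂, ?_⟩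
  rintro a (rfl | rfl) b (rfl | rfl)
  · exact ⟨d₁, d₂⟩
  · exact ⟨d₃, fun e => d₄ (by simpa [Q.star_star] using Q.star_antitone e)⟩
  · exact ⟨d₄, fun e => d₃ (by simpa [Q.star_star] using Q.star_antitone e)⟩
  · exact ⟨fun e => d₂ (by simpa [Q.star_star] using Q.star_antitone e),
      fun e => d₁ (by simpa [Q.star_star] using Q.star_antitone e)⟩

theorem sameHyp_iff_mem_orient : Q.sameHyp h k ↔ k ∈ Q.orient h := Iff.rfl

theorem mem_orient_comm : h ∈ Q.orient k ↔ k ∈ Q.orient h := by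
  constructor <;> intro hm
  · rw [Q.orient_eq_of_mem hm]; exact Q.self_mem_orient k
  · rw [Q.orient_eq_of_mem hm]; exact Q.self_mem_orient h

theorem disjointHyp_congr (hx : x ∈ Q.orient h) (hy : y ∈ Q.orient k) :
    Q.disjointHyp x y ↔ Q.disjointHyp h k := by
  have e : Q.sameHyp x y ↔ Q.sameHyp h k := by
    rw [sameHyp_iff_mem_orient, sameHyp_iff_mem_orient, Q.orient_eq_of_mem hx,
      Q.mem_orient_comm, Q.orient_eq_of_mem hy, Q.mem_orient_comm]
  simp only [disjointHyp, transverse, Q.orient_eq_of_mem hx, Q.orient_eq_of_mem hy, e]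

theorem disjointHyp_comm (hd : Q.disjointHyp h k) : Q.disjointHyp k h := by
  have e : ∀ {u v : P}, ¬ Q.sameHyp u v → ¬ Q.sameHyp v u := by
    intro u v hn hm
    exact hn (Q.mem_orient_comm.1 hm)
  refine ⟨e hd.1, fun ht => hd.2 ⟨hd.1, fun a ha b hb => ?_⟩⟩
  exact (ht.2 b hb a ha).symm

/-- The hyperplane of `x` lies in the halfspace `m`. -/
def HypIn (m x : P) : Prop := Q.lt x m ∨ Q.lt (Q.star x) m

theorem hypIn_star_iff : Q.HypIn m (Q.star x) ↔ Q.HypIn m x := by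
  simp only [HypIn, Q.star_star]
  exact or_comm

theorem hypIn_or_of_disjointHyp (hd : Q.disjointHyp x m) : Q.HypIn m x ∨ Q.HypIn (Q.star m) x := by
  rcases Q.eq_or_lt_of_not_transverse hd.2 with e | e | e | e | e | e
  · exact (hd.1 (Or.inl e)).elim
  · exact (hd.1 (Or.inr e)).elim
  · exact Or.inl (Or.inl e)
  · exact Or.inr (Or.inr (Q.star_lt_star e))
  · exact Or.inr (Or.inl e)
  · exact Or.inl (Or.inr e)

theorem not_hypIn_star (h₁ : Q.HypIn m x) (h₂ : Q.HypIn (Q.star m) x) : False := by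
  rcases h₁ with h₁ | h₁ <;> rcases h₂ with h₂ | h₂
  · exact Q.not_lt_star_of_lt h₁ h₂
  · exact Q.lt_asymm' h₁ (by simpa [Q.star_star] using Q.star_lt_star h₂)
  · exact Q.lt_asymm' h₁ (Q.lt_star_comm h₂)
  · exact Q.not_lt_star_of_lt h₁ h₂

theorem separates_of_hypIn (h₁ : Q.HypIn m x) (h₂ : Q.HypIn (Q.star m) y) :
    Q.separates m x y := by
  have h₁' : ∃ a ∈ Q.orient x, Q.lt a m := by
    rcases h₁ with h | h
    exacts [⟨_, Q.self_mem_orient x, h⟩, ⟨_, Q.star_mem_orient x, h⟩]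
  have h₂' : ∃ c ∈ Q.orient y, Q.lt m c := by
    rcases h₂ with h | h
    exacts [⟨_, Q.star_mem_orient y, Q.lt_star_comm h⟩,
      ⟨_, Q.self_mem_orient y, by simpa [Q.star_star] using Q.star_lt_star h⟩]
  obtain ⟨a, ha, h⟩ := h₁'
  obtain ⟨c, hc, h'⟩ := h₂'
  exact ⟨a, ha, m, Q.self_mem_orient m, c, hc, h, h'⟩

theorem facing_of_hypIn (h₁ : Q.HypIn x y) (h₂ : Q.HypIn y x) : Q.lt (Q.star x) y := by
  rcases h₂ with h₂ | h₂
  · rcases h₁ with h₁ | h₁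
    · exact (Q.lt_asymm' h₁ h₂).elim
    · exact (Q.not_lt_of_star_lt (Q.star_lt_comm h₁) h₂).elim
  · exact h₂

theorem exists_orient_facing (hd : Q.disjointHyp h k) :
    ∃ a ∈ Q.orient h, ∃ b ∈ Q.orient k, Q.lt (Q.star a) b := by
  rcases Q.hypIn_or_of_disjointHyp hd with (e | e) | (e | e)
  · exact ⟨_, Q.star_mem_orient h, _, Q.self_mem_orient k, by rwa [Q.star_star]⟩
  · exact ⟨_, Q.self_mem_orient h, _, Q.self_mem_orient k, e⟩
  · exact ⟨_, Q.star_mem_orient h, _, Q.star_mem_orient k, by rwa [Q.star_star]⟩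
  · exact ⟨_, Q.self_mem_orient h, _, Q.star_mem_orient k, e⟩

end Order

section Adjacency

variable {P : Type u} {P' : Type v} (Q : Pocset P) (Q' : Pocset P') (f : P → P')

/-- Facing halfspaces with the same image under `f` whose hyperplanes are inseparable among
the hyperplanes with that image. -/
def FoldAdj (x y : P) : Prop :=
  Q.facing x y ∧ f x = f y ∧ ∀ m, Q'.sameHyp (f m) (f x) → ¬ Q.separates m x y

variable {Q Q' f} {x y z : P}

theorem FoldAdj.symm (hxy : FoldAdj Q Q' f x y) : FoldAdj Q Q' f y x :=
  ⟨Q.star_lt_comm hxy.1, hxy.2.1.symm, fun m hm hs =>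
    hxy.2.2 m (hxy.2.1 ▸ hm) (Q.separates_comm hs)⟩

theorem IsAdmissibleMap.not_transverse (hf : IsAdmissibleMap Q Q' f)
    (h : Q'.sameHyp (f x) (f y)) : ¬ Q.transverse x y :=
  fun ht => (hf.am2 _ _ ht).1 h

theorem FoldAdj.trans (hf : IsAdmissibleMap Q Q' f) (hxy : FoldAdj Q Q' f x y)
    (hyz : FoldAdj Q Q' f y z) : x = z ∨ FoldAdj Q Q' f x z := by
  have hxz : f x = f z := hxy.2.1.trans hyz.2.1
  have hxy' := Q.star_lt_comm hxy.1
  have hyz' := Q.star_lt_comm hyz.1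
  rcases Q.eq_or_lt_of_not_transverse (hf.not_transverse (Or.inl hxz.symm)) with
    e | e | e | e | e | e
  · exact Or.inl e.symm
  · refine (Q'.ne_star (f x) ?_).elim
    rw [← hf.am1, ← e, hxz]
  · refine (hyz.2.2 x (Or.inl hxy.2.1.symm) (Q.separates_comm ?_)).elim
    rw [← Q.separates_congr (Q.star_mem_orient x) (Q.self_mem_orient z) (Q.self_mem_orient y)]
    exact Q.separates_of_between (Q.star_lt_star e) hxy.1
  · refine (hxy.2.2 z (Or.inl hxz) ?_).elim
    rw [← Q.separates_congr (Q.star_mem_orient z) (Q.self_mem_orient x) (Q.self_mem_orient y)]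
    exact Q.separates_of_between (Q.star_lt_star e) hyz'
  · exact (Q.not_lt_of_star_lt hyz' (Q.lt_trans' (Q.lt_star_comm e) hxy.1)).elim
  · refine Or.inr ⟨e, hxz, fun m hm hs => ?_⟩
    obtain ⟨b, hb, hxb, hbz⟩ := Q.exists_between_of_facing e hs
    have hb' : Q'.sameHyp (f b) (f x) := by
      rcases hb with rfl | rfl
      · exact hm
      · rcases hm with hm | hm
        · exact Or.inr (by rw [hf.am1, Q'.star_star, hm])
        · exact Or.inl (by rw [hf.am1, hm])
    rcases Q.eq_or_lt_of_not_transverse (hf.not_transverse (hxy.2.1 ▸ hb')) with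
      e | e | e | e | e | e
    · exact Q.not_lt_of_star_lt hyz.1 (e ▸ hbz)
    · refine Q.not_lt_star_of_lt hxy.1 ?_
      rw [e, Q.star_star]; exact hxb
    · exact hxy.2.2 b hb' (Q.separates_of_between hxb e)
    · exact Q.not_lt_of_star_lt hyz.1 (Q.lt_trans' e hbz)
    · exact Q.not_lt_star_of_lt hxy.1 (Q.lt_trans' hxb e)
    · exact hyz.2.2 b (hxy.2.1 ▸ hb')
        (Q.separates_of_between (Q.star_lt_comm e) hbz)

end Adjacency

section FoldRel

variable {P : Type u} {P' : Type v} {Q : Pocset P} {Q' : Pocset P'} {f : P → P'}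
  {G : Type w} [Group G] [MulAction G P] [MulAction G P']
  {r : P → P → Prop} {h₁ h₂ a b h k x y m : P}

theorem IsGAction.smul_lt (hG : Q.IsGAction G) (g : G) (hab : Q.lt a b) :
    Q.lt (g • a) (g • b) :=
  ⟨hG.smul_le g _ _ hab.1, fun e => hab.2 (MulAction.injective g e)⟩

theorem IsGAction.smul_mem_orient (hG : Q.IsGAction G) (g : G) (ha : a ∈ Q.orient h) :
    g • a ∈ Q.orient (g • h) := by
  rcases ha with rfl | rfl
  · exact Q.self_mem_orient _
  · rw [hG.smul_star]; exact Q.star_mem_orient _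

theorem IsGAction.smul_separates (hG : Q.IsGAction G) (g : G) (hs : Q.separates m x y) :
    Q.separates (g • m) (g • x) (g • y) := by
  obtain ⟨a, ha, b, hb, c, hc, hab, hbc⟩ := hs
  exact ⟨g • a, hG.smul_mem_orient g ha, g • b, hG.smul_mem_orient g hb, g • c,
    hG.smul_mem_orient g hc, hG.smul_lt g hab, hG.smul_lt g hbc⟩

theorem FoldAdj.smul (hG : Q.IsGAction G) (hG' : Q'.IsGAction G) (hequi : Equivariant G f)
    (g : G) (hxy : FoldAdj Q Q' f x y) : FoldAdj Q Q' f (g • x) (g • y) := by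
  refine ⟨?_, by rw [hequi, hequi, hxy.2.1], fun m hm hs => ?_⟩
  · have := hG.smul_lt g hxy.1
    rwa [hG.smul_star] at this
  · have h' := hG'.smul_mem_orient g⁻¹ hm
    rw [hequi, inv_smul_smul, ← hequi] at h'
    refine hxy.2.2 _ h' ?_
    simpa using hG.smul_separates g⁻¹ hs

/-- The generating pairs of the fold along `h₁`, `h₂`. -/
def FoldGen (Q : Pocset P) (G : Type w) [Group G] [MulAction G P] (h₁ h₂ x y : P) : Prop :=
  ∃ g : G, (x = g • h₁ ∧ y = g • h₂) ∨ (x = Q.star (g • h₁) ∧ y = Q.star (g • h₂))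

/-- A property invariant under the generating pairs of a fold is constant on its classes. -/
theorem IsFoldRel.iff_of_foldGen (hG : Q.IsGAction G) (hrel : Q.IsFoldRel G h₁ h₂ r)
    {p : P → Prop} (hp : ∀ x y, r a x → r a y → FoldGen Q G h₁ h₂ x y → (p x ↔ p y))
    (hab : r a b) : p a ↔ p b := by
  have hr : ∀ x y, Relation.EqvGen (FoldGen Q G h₁ h₂) x y → r x y := by
    intro x y hxy
    induction hxy with
    | rel x y hxy =>
      rcases hxy with ⟨g, ⟨rfl, rfl⟩ | ⟨rfl, rfl⟩⟩
      · exact hrel.ginv _ _ _ hrel.base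
      · exact hrel.sinv _ _ (hrel.ginv _ _ _ hrel.base)
    | refl x => exact hrel.equiv.refl x
    | symm x y _ ih => exact hrel.equiv.symm ih
    | trans x y z _ _ ih₁ ih₂ => exact hrel.equiv.trans ih₁ ih₂
  have hgen : Relation.EqvGen (FoldGen Q G h₁ h₂) a b := by
    refine hrel.min _ (Relation.EqvGen.is_equivalence _) ?_ ?_ ?_ a b hab
    · intro g x y hxy
      induction hxy with
      | rel x y hxy =>
        refine Relation.EqvGen.rel _ _ ?_
        rcases hxy with ⟨g', ⟨rfl, rfl⟩ | ⟨rfl, rfl⟩⟩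
        · exact ⟨g * g', Or.inl ⟨(mul_smul _ _ _).symm, (mul_smul _ _ _).symm⟩⟩
        · exact ⟨g * g', Or.inr ⟨by rw [hG.smul_star, mul_smul], by rw [hG.smul_star, mul_smul]⟩⟩
      | refl x => exact Relation.EqvGen.refl _
      | symm x y _ ih => exact Relation.EqvGen.symm _ _ ih
      | trans x y z _ _ ih₁ ih₂ => exact Relation.EqvGen.trans _ _ _ ih₁ ih₂
    · intro x y hxy
      induction hxy with
      | rel x y hxy =>
        refine Relation.EqvGen.rel _ _ ?_
        rcases hxy with ⟨g', ⟨rfl, rfl⟩ | ⟨rfl, rfl⟩⟩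
        · exact ⟨g', Or.inr ⟨rfl, rfl⟩⟩
        · exact ⟨g', Or.inl ⟨Q.star_star _, Q.star_star _⟩⟩
      | refl x => exact Relation.EqvGen.refl _
      | symm x y _ ih => exact Relation.EqvGen.symm _ _ ih
      | trans x y z _ _ ih₁ ih₂ => exact Relation.EqvGen.trans _ _ _ ih₁ ih₂
    · exact Relation.EqvGen.rel _ _ ⟨1, Or.inl ⟨(one_smul _ _).symm, (one_smul _ _).symm⟩⟩
  have key : ∀ x y, Relation.EqvGen (FoldGen Q G h₁ h₂) x y → r a x → (p x ↔ p y) := by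
    intro x y hxy
    induction hxy with
    | rel x y hxy =>
      intro hx
      exact hp x y hx (hrel.equiv.trans hx (hr _ _ (Relation.EqvGen.rel _ _ hxy))) hxy
    | refl x => exact fun _ => Iff.rfl
    | symm x y hxy ih => exact fun hy => (ih (hrel.equiv.trans hy (hr _ _ (hxy.symm)))).symm
    | trans x y z hxy _ ih₁ ih₂ =>
      exact fun hx => (ih₁ hx).trans (ih₂ (hrel.equiv.trans hx (hr _ _ hxy)))
  exact key a b hgen (hrel.equiv.refl a)

/-- The equivalence classes of an elementary fold are stars: any two distinct equivalent
halfspaces, or their complements, are adjacent. -/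
theorem IsFoldRel.eq_or_foldAdj (hG : Q.IsGAction G) (hG' : Q'.IsGAction G)
    (hf : IsAdmissibleMap Q Q' f) (hequi : Equivariant G f)
    (hadj : FoldAdj Q Q' f h₁ h₂) (hrel : Q.IsFoldRel G h₁ h₂ r) (hab : r a b) :
    a = b ∨ FoldAdj Q Q' f a b ∨ FoldAdj Q Q' f (Q.star a) (Q.star b) := by
  let pos : P → Prop := fun x => ∃ g : G, f x = g • f h₁
  have hpos : ∀ x, pos x → pos (Q.star x) → False := by
    rintro x ⟨g, hg⟩ ⟨g', hg'⟩
    rw [hf.am1, hg] at hg'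
    refine hG'.no_inversion (g⁻¹ * g') (f h₁) ?_
    rw [mul_smul, ← hg', hG'.smul_star, inv_smul_smul]
  have hposeq : ∀ x y, f x = f y → pos x → pos y := by
    rintro x y e ⟨g, hg⟩
    exact ⟨g, e ▸ hg⟩
  have hpossmul : ∀ (g : G) x, pos x → pos (g • x) := by
    rintro g x ⟨g', hg'⟩
    exact ⟨g * g', by rw [hequi, hg', mul_smul]⟩
  let T : P → P → Prop := fun x y => x = y ∨ (pos x ∧ FoldAdj Q Q' f x y) ∨
    (pos (Q.star x) ∧ FoldAdj Q Q' f (Q.star x) (Q.star y))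
  have hT : T a b := by
    refine hrel.min T ⟨fun x => Or.inl rfl, ?_, ?_⟩ ?_ ?_ ?_ a b hab
    · rintro x y (e | ⟨hp, e⟩ | ⟨hp, e⟩)
      · exact Or.inl e.symm
      · exact Or.inr (Or.inl ⟨hposeq _ _ e.2.1 hp, e.symm⟩)
      · exact Or.inr (Or.inr ⟨hposeq _ _ e.2.1 hp, e.symm⟩)
    · rintro x y z (rfl | ⟨hp, e⟩ | ⟨hp, e⟩) (rfl | ⟨hp', e'⟩ | ⟨hp', e'⟩)
      · exact Or.inl rfl
      · exact Or.inr (Or.inl ⟨hp', e'⟩)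
      · exact Or.inr (Or.inr ⟨hp', e'⟩)
      · exact Or.inr (Or.inl ⟨hp, e⟩)
      · rcases e.trans hf e' with e'' | e''
        · exact Or.inl e''
        · exact Or.inr (Or.inl ⟨hp, e''⟩)
      · exact (hpos y (hposeq _ _ e.2.1 hp) hp').elim
      · exact Or.inr (Or.inr ⟨hp, e⟩)
      · exact (hpos y hp' (hposeq _ _ e.2.1 hp)).elim
      · rcases e.trans hf e' with e'' | e''
        · exact Or.inl (by rw [← Q.star_star x, e'', Q.star_star])
        · exact Or.inr (Or.inr ⟨hp, e''⟩)
    · rintro g x y (rfl | ⟨hp, e⟩ | ⟨hp, e⟩)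
      · exact Or.inl rfl
      · exact Or.inr (Or.inl ⟨hpossmul g _ hp, e.smul hG hG' hequi g⟩)
      · refine Or.inr (Or.inr ⟨?_, ?_⟩)
        · rw [← hG.smul_star]; exact hpossmul g _ hp
        · rw [← hG.smul_star, ← hG.smul_star]; exact e.smul hG hG' hequi g
    · rintro x y (rfl | ⟨hp, e⟩ | ⟨hp, e⟩)
      · exact Or.inl rfl
      · exact Or.inr (Or.inr (by simpa only [Q.star_star] using ⟨hp, e⟩))
      · exact Or.inr (Or.inl ⟨hp, e⟩)
    · exact Or.inr (Or.inl ⟨⟨1, (one_smul _ _).symm⟩, hadj⟩)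
  rcases hT with e | ⟨-, e⟩ | ⟨-, e⟩
  exacts [Or.inl e, Or.inr (Or.inl e), Or.inr (Or.inr e)]

/-- If a hyperplane is disjoint from every element of a class, and separates no generating pair
within that class, then the class lies on one side of it. -/
theorem IsFoldRel.hypIn_of_rel (hG : Q.IsGAction G) (hrel : Q.IsFoldRel G h₁ h₂ r)
    (hd : ∀ x, r a x → Q.disjointHyp x m)
    (hs : ∀ x y, r a x → FoldGen Q G h₁ h₂ x y → ¬ Q.separates m x y)
    (hab : r a b) (hm : Q.HypIn m a) : Q.HypIn m b := by
  refine (hrel.iff_of_foldGen hG (p := fun x => Q.HypIn m x) ?_ hab).1 hm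
  intro x y hx hy hxy
  have hsep := hs x y hx hxy
  constructor <;> intro hin
  · exact (Q.hypIn_or_of_disjointHyp (hd y hy)).resolve_right
      fun h' => hsep (Q.separates_of_hypIn hin h')
  · exact (Q.hypIn_or_of_disjointHyp (hd x hx)).resolve_right
      fun h' => hsep (Q.separates_comm (Q.separates_of_hypIn hin h'))

theorem IsFoldRel.hypRel_equivalence (hrel : Q.IsFoldRel G h₁ h₂ r) :
    Equivalence (Q.hypRel r) := by
  refine ⟨fun x => Or.inl (hrel.equiv.refl x), ?_, ?_⟩
  · rintro x y (e | e)
    · exact Or.inl (hrel.equiv.symm e)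
    · refine Or.inr (hrel.equiv.symm ?_)
      simpa [Q.star_star] using hrel.sinv _ _ e
  · rintro x y z (e | e) (e' | e')
    · exact Or.inl (hrel.equiv.trans e e')
    · exact Or.inr (hrel.equiv.trans e e')
    · exact Or.inr (hrel.equiv.trans e (hrel.sinv _ _ e'))
    · refine Or.inl (hrel.equiv.trans e ?_)
      simpa [Q.star_star] using hrel.sinv _ _ e'

theorem IsFoldRel.hypRel_of_mem (hrel : Q.IsFoldRel G h₁ h₂ r) (ha : a ∈ Q.orient h) :
    Q.hypRel r h a := by
  rcases ha with rfl | rfl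
  · exact Or.inl (hrel.equiv.refl _)
  · refine Or.inr ?_
    rw [Q.star_star]; exact hrel.equiv.refl _

theorem IsFoldRel.exists_orient_rel (hrel : Q.IsFoldRel G h₁ h₂ r) (hx : Q.hypRel r h x) :
    ∃ a ∈ Q.orient h, r a x := by
  rcases hx with e | e
  · exact ⟨_, Q.self_mem_orient h, e⟩
  · exact ⟨_, Q.star_mem_orient h, by simpa [Q.star_star] using hrel.sinv _ _ e⟩

theorem IsFoldRel.sameHyp_of_hypRel
    (hf : IsAdmissibleMap Q Q' f) (hequi : Equivariant G f) (hadj : FoldAdj Q Q' f h₁ h₂)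
    (hrel : Q.IsFoldRel G h₁ h₂ r) (hxy : Q.hypRel r x y) : Q'.sameHyp (f y) (f x) := by
  have hmap : ∀ u v, r u v → f u = f v := fun u v huv => by
    refine hrel.min (fun u v => f u = f v) ⟨fun _ => rfl, Eq.symm, Eq.trans⟩ ?_ ?_ hadj.2.1 u v huv
    · intro g u v e
      rw [hequi, hequi, e]
    · intro u v e
      rw [hf.am1, hf.am1, e]
  rcases hxy with e | e
  · exact Or.inl (hmap _ _ e)
  · exact Or.inr (by rw [hmap _ _ e, hf.am1])

/-- A strong form of (AER4) for elementary folds. -/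
theorem IsFoldRel.rel_of_facing (hG : Q.IsGAction G) (hG' : Q'.IsGAction G)
    (hf : IsAdmissibleMap Q Q' f) (hequi : Equivariant G f)
    (hadj : FoldAdj Q Q' f h₁ h₂) (hrel : Q.IsFoldRel G h₁ h₂ r)
    (hab : Q.hypRel r a b) (hfac : Q.facing a b) : r a b := by
  rcases hab with e | e
  · exact e
  rcases hrel.eq_or_foldAdj hG hG' hf hequi hadj e with e | e | e
  · exact (hfac.2 (by rw [e, Q.star_star])).elim
  · exact (Q.not_lt_star_of_lt hfac e.1).elim
  · exact (Q.not_lt_of_star_lt hfac (by simpa [facing, Q.star_star] using e.1)).elim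

/-- A hyperplane separating a generating pair has an orientation between `g • h₁` and `g • h₂`
for some `g`. -/
theorem IsFoldRel.exists_between_of_separates (hG : Q.IsGAction G)
    (hrel : Q.IsFoldRel G h₁ h₂ r) (hfac : Q.facing h₁ h₂)
    (hx : Q.hypRel r h x) (hxy : FoldGen Q G h₁ h₂ x y) (hs : Q.separates m x y) :
    ∃ g : G, ∃ b ∈ Q.orient m, Q.hypRel r h (g • h₁) ∧
      Q.lt (Q.star (g • h₁)) b ∧ Q.lt b (g • h₂) := by
  obtain ⟨g, hg⟩ := hxy
  have hxm : x ∈ Q.orient (g • h₁) := hg.imp And.left And.left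
  have hym : y ∈ Q.orient (g • h₂) := hg.imp And.right And.right
  have hfac' : Q.facing (g • h₁) (g • h₂) := by
    have := hG.smul_lt g hfac
    rwa [hG.smul_star] at this
  rw [Q.separates_congr (Q.self_mem_orient m) hxm hym] at hs
  obtain ⟨b, hb, hb₁, hb₂⟩ := Q.exists_between_of_facing hfac' hs
  exact ⟨g, b, hb, hrel.hypRel_equivalence.trans hx
    (hrel.hypRel_of_mem (Q.mem_orient_comm.1 hxm)), hb₁, hb₂⟩

theorem IsFoldRel.hypIn_of_hypRel (hG : Q.IsGAction G) (hrel : Q.IsFoldRel G h₁ h₂ r)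
    (hd : ∀ x, Q.hypRel r a x → Q.disjointHyp x m)
    (hs : ∀ x y, Q.hypRel r a x → FoldGen Q G h₁ h₂ x y → ¬ Q.separates m x y)
    (hab : Q.hypRel r a b) (hm : Q.HypIn m a) : Q.HypIn m b := by
  rcases hab with e | e
  · exact hrel.hypIn_of_rel hG (fun x hx => hd x (Or.inl hx)) (fun x y hx => hs x y (Or.inl hx)) e hm
  · exact Q.hypIn_star_iff.1 (hrel.hypIn_of_rel hG (fun x hx => hd x (Or.inl hx))
      (fun x y hx => hs x y (Or.inl hx)) e hm)

theorem IsFoldRel.exists_between_of_separates_rel (hG : Q.IsGAction G)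
    (hrel : Q.IsFoldRel G h₁ h₂ r) (hfac : Q.facing h₁ h₂)
    (hd : ∀ x, Q.hypRel r a x → Q.disjointHyp x m)
    (hab : Q.hypRel r a b) (hs : Q.separates m a b) :
    ∃ g : G, ∃ c ∈ Q.orient m, Q.hypRel r a (g • h₁) ∧
      Q.lt (Q.star (g • h₁)) c ∧ Q.lt c (g • h₂) := by
  by_contra hn
  obtain ⟨u, hu, v, hv, w, hw, huv, hvw⟩ := hs
  have hin : Q.HypIn v a := by
    rcases hu with rfl | rfl
    exacts [Or.inl huv, Or.inr huv]
  have hout : Q.HypIn (Q.star v) b := by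
    rcases hw with rfl | rfl
    · exact Or.inr (Q.star_lt_star hvw)
    · exact Or.inl (Q.lt_star_comm hvw)
  refine Q.not_hypIn_star (hrel.hypIn_of_hypRel hG ?_ ?_ hab hin) hout
  · intro x hx
    rw [Q.disjointHyp_congr (Q.self_mem_orient x) hv]
    exact hd x hx
  · intro x y hx hxy hsep
    rw [Q.separates_congr hv (Q.self_mem_orient x) (Q.self_mem_orient y)] at hsep
    exact hn (hrel.exists_between_of_separates hG hfac hx hxy hsep)

theorem IsFoldRel.rel_of_inseparable (hG : Q.IsGAction G) (hG' : Q'.IsGAction G)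
    (hf : IsAdmissibleMap Q Q' f) (hequi : Equivariant G f)
    (hadj : FoldAdj Q Q' f h₁ h₂) (hrel : Q.IsFoldRel G h₁ h₂ r) {a' b' : P}
    (haa : Q.hypRel r a a') (hbb : Q.hypRel r b b')
    (hA : ∀ x x' y, Q.hypRel r a x → Q.hypRel r a x' → Q.hypRel r b y →
      Q.HypIn y x → Q.HypIn y x')
    (hB : ∀ y y' x, Q.hypRel r b y → Q.hypRel r b y' → Q.hypRel r a x →
      Q.HypIn x y → Q.HypIn x y')
    (hab : Q.lt (Q.star a) b) (hab' : Q.lt (Q.star a') b')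
    (hi : ¬ Q.separates a' a b) (hi' : ¬ Q.separates a a' b') : r a a' := by
  have ra := hrel.hypRel_equivalence.refl a
  have rb := hrel.hypRel_equivalence.refl b
  have h₁₂ : Q.lt (Q.star a) b' := Q.facing_of_hypIn
    (hB b b' a rb hbb ra (Or.inr (Q.star_lt_comm hab)))
    (hA a' a b' haa ra hbb (Or.inr hab'))
  have h₂₁ : Q.lt (Q.star a') b := Q.facing_of_hypIn
    (hB b' b a' hbb rb haa (Or.inr (Q.star_lt_comm hab')))
    (hA a a' b ra haa rb (Or.inr hab))
  rcases Q.eq_or_lt_of_not_transverse (hf.not_transverse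
    (Q'.mem_orient_comm.1 (hrel.sameHyp_of_hypRel hf hequi hadj haa))) with e | e | e | e | e | e
  · rw [e]; exact hrel.equiv.refl a
  · refine (Q.not_lt_of_star_lt hab ?_).elim
    rwa [e, Q.star_star] at h₂₁
  · refine (hi' ?_).elim
    rw [← Q.separates_congr (Q.star_mem_orient a) (Q.self_mem_orient a') (Q.self_mem_orient b')]
    exact Q.separates_of_between (Q.star_lt_star e) h₁₂
  · refine (hi ?_).elim
    rw [← Q.separates_congr (Q.star_mem_orient a') (Q.self_mem_orient a) (Q.self_mem_orient b)]
    exact Q.separates_of_between (Q.star_lt_star e) h₂₁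
  · exact (Q.not_lt_of_star_lt hab (Q.lt_trans' e h₂₁)).elim
  · exact hrel.rel_of_facing hG hG' hf hequi hadj haa e

/-- Hyperplanes transverse after the fold have transverse representatives, or one has a
representative between folded halfspaces of the other's class. -/
theorem IsFoldRel.foldTransCase_or (hG : Q.IsGAction G) (hG' : Q'.IsGAction G)
    (hf : IsAdmissibleMap Q Q' f) (hequi : Equivariant G f)
    (hadj : FoldAdj Q Q' f h₁ h₂) (hrel : Q.IsFoldRel G h₁ h₂ r)
    (ht : Q.QuotTransverse r h k) :
    (∃ x y, Q.hypRel r h x ∧ Q.hypRel r k y ∧ Q.transverse x y) ∨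
    (∃ g : G, ∃ y, Q.hypRel r h (g • h₁) ∧ Q.hypRel r k y ∧
      Q.lt (Q.star (g • h₁)) y ∧ Q.lt y (g • h₂)) ∨
    (∃ g : G, ∃ x, Q.hypRel r k (g • h₁) ∧ Q.hypRel r h x ∧
      Q.lt (Q.star (g • h₁)) x ∧ Q.lt x (g • h₂)) := by
  by_contra hn
  push Not at hn
  obtain ⟨n₁, n₂, n₃⟩ := hn
  have E := hrel.hypRel_equivalence
  have hd : ∀ x y, Q.hypRel r h x → Q.hypRel r k y → Q.disjointHyp x y := fun x y hx hy =>
    ⟨fun e => ht.1 (E.trans hx (E.trans (hrel.hypRel_of_mem e) (E.symm hy))), n₁ x y hx hy⟩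
  have hA : ∀ x x' y, Q.hypRel r h x → Q.hypRel r h x' → Q.hypRel r k y →
      Q.HypIn y x → Q.HypIn y x' := by
    intro x x' y hx hx' hy
    refine hrel.hypIn_of_hypRel hG (fun z hz => hd z y (E.trans hx hz) hy) ?_
      (E.trans (E.symm hx) hx')
    intro u v hu huv hs
    obtain ⟨g, b, hb, hg, hb₁, hb₂⟩ :=
      hrel.exists_between_of_separates hG hadj.1 (E.trans hx hu) huv hs
    exact n₂ g b hg (E.trans hy (hrel.hypRel_of_mem hb)) hb₁ hb₂
  have hB : ∀ y y' x, Q.hypRel r k y → Q.hypRel r k y' → Q.hypRel r h x →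
      Q.HypIn x y → Q.HypIn x y' := by
    intro y y' x hy hy' hx
    refine hrel.hypIn_of_hypRel hG
      (fun z hz => Q.disjointHyp_comm (hd x z hx (E.trans hy hz))) ?_ (E.trans (E.symm hy) hy')
    intro u v hu huv hs
    obtain ⟨g, b, hb, hg, hb₁, hb₂⟩ :=
      hrel.exists_between_of_separates hG hadj.1 (E.trans hy hu) huv hs
    exact n₃ g b hg (E.trans hx (hrel.hypRel_of_mem hb)) hb₁ hb₂
  have hins : ∀ a ∈ Q.orient h, ∀ b ∈ Q.orient k, ∃ x y, r a x ∧ r b y ∧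
      (∀ m, Q.hypRel r h m ∨ Q.hypRel r k m → ¬ Q.separates m x y) ∧ ¬ Q.lt x y := by
    intro a ha b hb
    by_contra hc
    push Not at hc
    have ha' := hrel.hypRel_of_mem ha
    have hb' := hrel.hypRel_of_mem hb
    refine (ht.2 a ha b hb).1 (Or.inr ⟨?_, ?_, ?_⟩)
    · exact fun e => (ht.2 a ha b hb).1 (Or.inl e)
    · exact fun x y hx hy => hd x y (E.trans ha' (Or.inl hx)) (E.trans hb' (Or.inl hy))
    · intro x y hx hy hs
      refine hc x y hx hy fun m hm => hs m ?_
      exact hm.imp (E.trans (E.symm ha')) (E.trans (E.symm hb'))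
  obtain ⟨x, y, hx, hy, hxy, -⟩ := hins h (Q.self_mem_orient h) k (Q.self_mem_orient k)
  obtain ⟨a, ha, b, hb, hab⟩ := Q.exists_orient_facing (hd x y (Or.inl hx) (Or.inl hy))
  have hha : Q.hypRel r h a := E.trans (Or.inl hx) (hrel.hypRel_of_mem ha)
  have hkb : Q.hypRel r k b := E.trans (Or.inl hy) (hrel.hypRel_of_mem hb)
  obtain ⟨c, hc, hca⟩ := hrel.exists_orient_rel hha
  obtain ⟨d, hd', hdb⟩ := hrel.exists_orient_rel hkb
  have hc' : Q.star c ∈ Q.orient h := by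
    rw [← Q.orient_eq_of_mem hc]; exact Q.star_mem_orient c
  obtain ⟨x', y', hx', hy', hxy', hlt⟩ := hins _ hc' d hd'
  have hhx' : Q.hypRel r h x' := E.trans (hrel.hypRel_of_mem hc') (Or.inl hx')
  have hky' : Q.hypRel r k y' := E.trans (hrel.hypRel_of_mem hd') (Or.inl hy')
  obtain ⟨a', ha', b', hb', hab'⟩ := Q.exists_orient_facing (hd x' y' hhx' hky')
  have hha' : Q.hypRel r h a' := E.trans hhx' (hrel.hypRel_of_mem ha')
  have hkb' : Q.hypRel r k b' := E.trans hky' (hrel.hypRel_of_mem hb')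
  have hsep : ∀ m, Q.hypRel r h m ∨ Q.hypRel r k m → ¬ Q.separates m a b := fun m hm hs =>
    hxy m hm ((Q.separates_congr (Q.self_mem_orient m) ha hb).1 hs)
  have hsep' : ∀ m, Q.hypRel r h m ∨ Q.hypRel r k m → ¬ Q.separates m a' b' := fun m hm hs =>
    hxy' m hm ((Q.separates_congr (Q.self_mem_orient m) ha' hb').1 hs)
  have hA' : ∀ x x' y, Q.hypRel r a x → Q.hypRel r a x' → Q.hypRel r b y →
      Q.HypIn y x → Q.HypIn y x' := fun x x' y hx hx' hy =>
    hA x x' y (E.trans hha hx) (E.trans hha hx') (E.trans hkb hy)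
  have hB' : ∀ y y' x, Q.hypRel r b y → Q.hypRel r b y' → Q.hypRel r a x →
      Q.HypIn x y → Q.HypIn x y' := fun y y' x hy hy' hx =>
    hB y y' x (E.trans hkb hy) (E.trans hkb hy') (E.trans hha hx)
  have haa' : r a a' := hrel.rel_of_inseparable hG hG' hf hequi hadj
    (E.trans (E.symm hha) hha') (E.trans (E.symm hkb) hkb') hA' hB' hab hab'
    (hsep a' (Or.inl hha')) (hsep' a (Or.inl hha))
  have hbb' : r b b' := hrel.rel_of_inseparable hG hG' hf hequi hadj
    (E.trans (E.symm hkb) hkb') (E.trans (E.symm hha) hha') hB' hA'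
    (Q.star_lt_comm hab) (Q.star_lt_comm hab')
    (fun hs => hsep b' (Or.inr hkb') (Q.separates_comm hs))
    (fun hs => hsep' b (Or.inr hkb) (Q.separates_comm hs))
  have hns : ∀ u, ¬ r u (Q.star u) := by
    intro u e
    rcases hrel.eq_or_foldAdj hG hG' hf hequi hadj e with e | e | e
    · exact Q.ne_star u e
    · exact e.1.2 rfl
    · exact e.1.2 rfl
  have hca' : r c a' := hrel.equiv.trans hca haa'
  have hdb' : r d b' := hrel.equiv.trans hdb hbb'
  have e₁ : x' = Q.star a' := by
    rcases ha' with rfl | rfl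
    · exact (hns _ (hrel.equiv.trans hca' (hrel.equiv.symm hx'))).elim
    · rw [Q.star_star]
  have e₂ : y' = b' := by
    rcases hb' with rfl | rfl
    · rfl
    · exact (hns _ (hrel.equiv.trans (hrel.equiv.symm hy') hdb')).elim
  exact hlt (by rw [e₁, e₂]; exact hab')

theorem not_separates_of_between (hab : Q.lt (Q.star x) k) (hkb : Q.lt k y)
    (hm : Q.sameHyp k m ∨ ¬ Q.separates m x y) : ¬ Q.separates m x k := by
  intro hs
  obtain ⟨b, hb, hb₁, hb₂⟩ := Q.exists_between_of_facing hab hs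
  rcases hm with hm | hm
  · have hbk : b ∈ Q.orient k := by rwa [Q.orient_eq_of_mem hm] at hb
    rcases hbk with rfl | rfl
    · exact hb₂.2 rfl
    · exact Q.not_star_le k hb₂.1
  · refine hm ?_
    rw [← Q.separates_congr hb (Q.self_mem_orient x) (Q.self_mem_orient y)]
    exact Q.separates_of_between hb₁ (Q.lt_trans' hb₂ hkb)

theorem IsFoldRel.not_quotLT_of_between (hrel : Q.IsFoldRel G h₁ h₂ r) {c d : P}
    (hac : Q.hypRel r a c) (hcd : r c d) (hk : k ∈ Q.orient b)
    (hck : Q.lt (Q.star c) k) (hkd : Q.lt k d)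
    (hi : ∀ m, Q.hypRel r a m ∨ Q.hypRel r b m → Q.sameHyp k m ∨ ¬ Q.separates m c d) :
    ¬ Q.QuotLT r a b ∧ ¬ Q.QuotLT r b a := by
  have hi₁ : ∀ m, Q.hypRel r a m ∨ Q.hypRel r b m → ¬ Q.separates m c k := fun m hm =>
    not_separates_of_between hck hkd (hi m hm)
  have hi₂ : ∀ m, Q.hypRel r a m ∨ Q.hypRel r b m → ¬ Q.separates m d k := by
    intro m hm hs
    rw [← Q.separates_congr (Q.self_mem_orient m) (Q.self_mem_orient d)
      (Q.star_mem_orient k)] at hs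
    refine not_separates_of_between (Q.star_lt_star hkd)
      (by simpa [Q.star_star] using Q.star_lt_star hck) ?_ hs
    refine (hi m hm).imp (fun e => ?_) fun e e' => e (Q.separates_comm e')
    rw [sameHyp_iff_mem_orient, Q.orient_star]
    exact e
  have hb : b ∈ Q.orient k := Q.mem_orient_comm.1 hk
  have hsx : ∀ z m, Q.separates m (Q.star z) b → Q.separates m z k := fun z m =>
    (Q.separates_congr (Q.self_mem_orient m) (Q.star_mem_orient z) hb).1
  have hs : ∀ z m, Q.separates m z b → Q.separates m z k := fun z m =>
    (Q.separates_congr (Q.self_mem_orient m) (Q.self_mem_orient z) hb).1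
  have rb := hrel.equiv.refl b
  constructor
  · rintro ⟨-, -, hq⟩
    rcases hac with hac | hac
    · have q₁ := hq c b hac rb fun m hm e => hi₁ m hm (hs c m e)
      have q₂ := hq d b (hrel.equiv.trans hac hcd) rb fun m hm e => hi₂ m hm (hs d m e)
      rcases hb with rfl | rfl
      · exact Q.not_lt_of_star_lt hck q₁
      · exact Q.not_lt_star_of_lt hkd (Q.lt_star_comm q₂)
    · have q₁ := hq _ b hac rb fun m hm e => hi₁ m hm (hsx c m e)
      have q₂ := hq _ b (hrel.equiv.trans hac (hrel.sinv _ _ hcd)) rb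
        fun m hm e => hi₂ m hm (hsx d m e)
      rcases hb with rfl | rfl
      · exact Q.not_lt_of_star_lt (Q.star_lt_comm q₂) hkd
      · exact Q.not_lt_star_of_lt hck q₁
  · rintro ⟨-, -, hq⟩
    rcases hac with hac | hac
    · have q₁ := hq b c rb hac fun m hm e => hi₁ m hm.symm (hs c m (Q.separates_comm e))
      have q₂ := hq b d rb (hrel.equiv.trans hac hcd)
        fun m hm e => hi₂ m hm.symm (hs d m (Q.separates_comm e))
      rcases hb with rfl | rfl
      · exact Q.not_lt_of_star_lt (Q.star_lt_comm hck) q₁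
      · exact Q.not_lt_of_star_lt q₂ hkd
    · have q₁ := hq b _ rb hac fun m hm e => hi₁ m hm.symm (hsx c m (Q.separates_comm e))
      have q₂ := hq b _ rb (hrel.equiv.trans hac (hrel.sinv _ _ hcd))
        fun m hm e => hi₂ m hm.symm (hsx d m (Q.separates_comm e))
      rcases hb with rfl | rfl
      · exact Q.not_lt_star_of_lt hkd q₂
      · exact Q.not_lt_of_star_lt hck (by simpa [Q.star_star] using Q.star_lt_star q₁)

/-- A hyperplane separating two equivalent hyperplanes is transverse to them after the fold. -/
theorem IsFoldRel.quotTransverse_of_separates (hG : Q.IsGAction G) (hG' : Q'.IsGAction G)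
    (hf : IsAdmissibleMap Q Q' f) (hequi : Equivariant G f)
    (hfold : ElemFoldable Q Q' f h₁ h₂) (hrel : Q.IsFoldRel G h₁ h₂ r)
    (hab : Q.hypRel r a b) (hne : ¬ Q.sameHyp a b) (hs : Q.separates k a b) :
    Q.QuotTransverse r a k := by
  have hadj : FoldAdj Q Q' f h₁ h₂ := ⟨hfold.1, hfold.2.1, hfold.2.2.1⟩
  have E := hrel.hypRel_equivalence
  have hsame : ∀ {x y}, Q.hypRel r x y → Q'.sameHyp (f y) (f x) :=
    fun e => hrel.sameHyp_of_hypRel hf hequi hadj e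
  have hstar : ∀ {x y z}, Q'.sameHyp (f x) (f y) → Q.sameHyp y z → Q'.sameHyp (f x) (f z) := by
    rintro x y z e (rfl | rfl)
    · exact e
    · rw [hf.am1, sameHyp_iff_mem_orient, ← Q'.orient_eq_of_mem e]
      exact Q'.star_mem_orient _
  have hak : ¬ Q.hypRel r a k := by
    intro hak
    have hk := hsame hak
    have key : ∀ c ∈ Q.orient b, r a c → False := by
      intro c hc hac
      rcases hrel.eq_or_foldAdj hG hG' hf hequi hadj hac with e | e | e
      · exact hne (Q.mem_orient_comm.1 (e ▸ hc))
      · exact e.2.2 k hk ((Q.separates_congr (Q.self_mem_orient k) (Q.self_mem_orient a) hc).2 hs)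
      · refine e.2.2 k (hstar hk (Or.inr rfl)) ?_
        rw [Q.separates_congr (Q.self_mem_orient k) (Q.star_mem_orient a) (Q.star_mem_orient c)]
        exact (Q.separates_congr (Q.self_mem_orient k) (Q.self_mem_orient a) hc).2 hs
    exact hab.elim (key _ (Q.self_mem_orient b)) (key _ (Q.star_mem_orient b))
  have main : (∀ x y, Q.hypRel r a x → Q.hypRel r k y → Q.disjointHyp x y) →
      ∀ a' ∈ Q.orient a, ∀ k' ∈ Q.orient k, ¬ Q.QuotLT r a' k' ∧ ¬ Q.QuotLT r k' a' := by
    intro hd a' ha k' hk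
    obtain ⟨g, c, hc, hag, hc₁, hc₂⟩ := hrel.exists_between_of_separates_rel hG hadj.1
      (fun x hx => hd x k hx (E.refl k)) hab hs
    have haa := hrel.hypRel_of_mem ha
    have hkk := hrel.hypRel_of_mem hk
    refine hrel.not_quotLT_of_between (E.trans (E.symm haa) hag) (hrel.ginv g _ _ hrel.base)
      (by rwa [Q.orient_eq_of_mem hk]) hc₁ hc₂ ?_
    rintro m (hm | hm)
    · refine Or.inr ((hadj.smul hG hG' hequi g).2.2 m ?_)
      exact hsame (E.trans (E.symm hag) (E.trans haa hm))
    · by_cases hcm : Q.sameHyp c m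
      · exact Or.inl hcm
      refine Or.inr fun hsm => ?_
      have hcm' : Q.hypRel r c m :=
        E.trans (E.symm (hrel.hypRel_of_mem hc)) (E.trans hkk hm)
      refine hfold.2.2.2 (g⁻¹ • c) (g⁻¹ • m) ?_ ?_ ⟨?_, ?_⟩
      · have h' := hG'.smul_mem_orient g⁻¹ (hsame (E.symm hcm'))
        rwa [← hequi, ← hequi] at h'
      · intro e
        have h' := hG.smul_mem_orient g e
        rw [smul_inv_smul, smul_inv_smul] at h'
        exact hcm h'
      · simpa using hG.smul_separates g⁻¹ (Q.separates_of_between hc₁ hc₂)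
      · simpa using hG.smul_separates g⁻¹ hsm
  have hdis : ∀ a' ∈ Q.orient a, ∀ k' ∈ Q.orient k,
      (∀ x y, r a' x → r k' y → Q.disjointHyp x y) →
      ∀ x y, Q.hypRel r a x → Q.hypRel r k y → Q.disjointHyp x y := by
    intro a' ha k' hk hd x y hx hy
    obtain ⟨u, hu, hux⟩ : ∃ u ∈ Q.orient x, r a' u :=
      (E.trans (E.symm (hrel.hypRel_of_mem ha)) hx).elim
        (fun e => ⟨_, Q.self_mem_orient x, e⟩) fun e => ⟨_, Q.star_mem_orient x, e⟩
    obtain ⟨v, hv, hvy⟩ : ∃ v ∈ Q.orient y, r k' v :=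
      (E.trans (E.symm (hrel.hypRel_of_mem hk)) hy).elim
        (fun e => ⟨_, Q.self_mem_orient y, e⟩) fun e => ⟨_, Q.star_mem_orient y, e⟩
    exact (Q.disjointHyp_congr hu hv).1 (hd u v hux hvy)
  refine ⟨hak, fun a' ha k' hk => ?_⟩
  have hrak : ∀ {x y}, x ∈ Q.orient a → y ∈ Q.orient k → ¬ r x y := fun hx hy e =>
    hak (E.trans (hrel.hypRel_of_mem hx) (E.trans (Or.inl e) (E.symm (hrel.hypRel_of_mem hy))))
  constructor
  · rintro (e | e)
    · exact hrak ha hk e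
    · exact (main (hdis a' ha k' hk e.2.1) a' ha k' hk).1 e
  · rintro (e | e)
    · exact hrak ha hk (hrel.equiv.symm e)
    · exact (main (hdis a' ha k' hk fun x y hx hy =>
        Q.disjointHyp_comm (e.2.1 y x hy hx)) a' ha k' hk).2 e

end FoldRel

end Pocset


/-- description of transverse hyperplanes after an elementary
fold, together with the converse: a hyperplane separating two distinct
`∼`-equivalent hyperplanes becomes transverse to them in the quotient. -/
theorem transverse_after_elementary_fold {P : Type u} {P' : Type v}
    (Q : Pocset P) (Q' : Pocset P')
    (hLF : Q.LocallyFinite) (hLF' : Q'.LocallyFinite)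
    (G : Type w) [Group G] [MulAction G P] [MulAction G P']
    (hG : Q.IsGAction G) (hG' : Q'.IsGAction G)
    (f : P → P') (hres : Pocset.IsResolution Q Q' f)
    (hequi : Pocset.Equivariant G f)
    (h₁ h₂ : P) (hfold : Pocset.ElemFoldable Q Q' f h₁ h₂)
    (r : P → P → Prop) (hrel : Q.IsFoldRel G h₁ h₂ r) :
    (∀ h k : P, Q.QuotTransverse r h k →
      Q.foldTransCase G r h₁ h₂ h k ∨ Q.foldTransCase G r h₁ h₂ k h) ∧
    (∀ h h' k : P, Q.hypRel r h h' → ¬ Q.sameHyp h h' → Q.separates k h h' →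
      Q.QuotTransverse r h k) := by
  have hadj : Pocset.FoldAdj Q Q' f h₁ h₂ := ⟨hfold.1, hfold.2.1, hfold.2.2.1⟩
  refine ⟨fun h k ht => ?_, fun h h' k hhh hne hs =>
    hrel.quotTransverse_of_separates hG hG' hres.adm hequi hfold hhh hne hs⟩
  rcases hrel.foldTransCase_or hG hG' hres.adm hequi hadj ht with
    ⟨x, y, hx, hy, hxy⟩ | ⟨g, y, hg, hy, hy₁, hy₂⟩ | ⟨g, x, hg, hx, hx₁, hx₂⟩
  · obtain ⟨a, ha, hax⟩ := hrel.exists_orient_rel hx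
    obtain ⟨b, hb, hby⟩ := hrel.exists_orient_rel hy
    exact Or.inl ⟨a, ha, b, hb, Or.inl ⟨x, y, hax, hby, hxy⟩⟩
  · obtain ⟨a, ha, hag⟩ := hrel.exists_orient_rel hg
    obtain ⟨b, hb, hby⟩ := hrel.exists_orient_rel hy
    exact Or.inl ⟨a, ha, b, hb, Or.inr ⟨g, y, hby, Or.inl ⟨hag, hy₁, hy₂⟩⟩⟩
  · obtain ⟨a, ha, hag⟩ := hrel.exists_orient_rel hg
    obtain ⟨b, hb, hbx⟩ := hrel.exists_orient_rel hx
    exact Or.inr ⟨a, ha, b, hb, Or.inr ⟨g, x, hbx, Or.inl ⟨hag, hx₁, hx₂⟩⟩⟩
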